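/- There are exactly 32 signed matched triple configurations in which the arc A₀ is the arc containing the two heads and all three chords have the same 3-sign. (This is the count of 3-movable triples, up to rotation placing the head–head arc at A₀, underlying the theorem that a matched triple of chords in a Gauss diagram is 3-movable, i.e., repositionable by a Reidemeister 3 move, if and only if its chords all have the same 3-sign.) -/

import Mathlib

/-- The six points `0,…,5`, placed counterclockwise on the circle. -/
abbrev Pt := Fin 6

/-- The arc containing a point: the arcs are `A₀ = {0,1}`, `A₁ = {2,3}`, `A₂ = {4,5}`. -/
def arcOf (x : Pt) : Fin 3 := ⟨x.val / 2, by omega⟩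

/-- The first point `2k` of arc `Aₖ`. -/
def p0 (k : Fin 3) : Pt := ⟨2 * k.val, by omega⟩

/-- The second point `2k+1` of arc `Aₖ`. -/
def p1 (k : Fin 3) : Pt := ⟨2 * k.val + 1, by omega⟩

/-- `m` is a perfect matching of the six points into three chords:
a fixed-point-free involution; `m x` is the other endpoint of the chord at `x`. -/
def IsMatching (m : Pt → Pt) : Prop := (∀ x, m (m x) = x) ∧ (∀ x, m x ≠ x)

/-- Each chord is directed: `h x = true` iff `x` is the head of its chord,
so the two endpoints of any chord consist of one head and one tail. -/
def HeadTail (m : Pt → Pt) (h : Pt → Bool) : Prop := ∀ x, h (m x) = ! h x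

/-- The sign `ε ∈ {+1, -1}` (an element of `ℤˣ`) is attached to chords:
both endpoints of a chord carry the same sign. -/
def SignOnChords (m : Pt → Pt) (s : Pt → ℤˣ) : Prop := ∀ x, s (m x) = s x


instance (m : Pt → Pt) : Decidable (IsMatching m) := by
  unfold IsMatching; infer_instance

instance (m : Pt → Pt) (h : Pt → Bool) : Decidable (HeadTail m h) := by
  unfold HeadTail; infer_instance

instance (m : Pt → Pt) (s : Pt → ℤˣ) : Decidable (SignOnChords m s) := by
  unfold SignOnChords; infer_instance

/-- The chords `{a,b}` and `{c,d}` cross: their endpoint pairs interleave in the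
cyclic order `0,1,2,3,4,5`, i.e. exactly one of `c, d` lies strictly between `a` and `b`. -/
def Crosses (a b c d : Pt) : Prop :=
  ((min a b < c ∧ c < max a b) ∧ ¬(min a b < d ∧ d < max a b)) ∨
    ((min a b < d ∧ d < max a b) ∧ ¬(min a b < c ∧ c < max a b))


instance (a b c d : Pt) : Decidable (Crosses a b c d) := by
  unfold Crosses; infer_instance

/-- The parity of the chord through `x` in the triple: `+1` if it crosses an even
number of the other two chords, `-1` if odd.  The other chords are enumerated by
their representatives `y` with `y < m y`. -/
def parity (m : Pt → Pt) (x : Pt) : ℤˣ :=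
  if (Finset.univ.filter
      (fun y : Pt => y < m y ∧ y ≠ x ∧ y ≠ m x ∧ Crosses x (m x) y (m y))).card % 2 = 0
  then 1 else -1

/-- The head endpoint of the chord through `x`. -/
def headPt (m : Pt → Pt) (h : Pt → Bool) (x : Pt) : Pt := if h x then x else m x

/-- The tail endpoint of the chord through `x`. -/
def tailPt (m : Pt → Pt) (h : Pt → Bool) (x : Pt) : Pt := if h x then m x else x

/-- The direction of the chord through `x`: `+1` (counterclockwise) if, with tail in
arc `Aᵢ` and head in arc `Aⱼ`, we have `j ≡ i + 1 (mod 3)`; `-1` (clockwise) otherwise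
(for chords of a matched triple this is exactly the case `j ≡ i - 1 (mod 3)`). -/
def direction (m : Pt → Pt) (h : Pt → Bool) (x : Pt) : ℤˣ :=
  if arcOf (headPt m h x) = arcOf (tailPt m h x) + 1 then 1 else -1

/-- The 3-sign of the chord through `x`: the product of its sign, parity and direction. -/
def threeSign (m : Pt → Pt) (h : Pt → Bool) (s : Pt → ℤˣ) (x : Pt) : ℤˣ :=
  s x * parity m x * direction m h x

/-- The triple is matched: one arc contains two heads, one arc contains two tails,
and the remaining arc contains one head and one tail belonging to two distinct chords. -/
def Matched (m : Pt → Pt) (h : Pt → Bool) : Prop :=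
  ∃ a b c : Fin 3, a ≠ b ∧ a ≠ c ∧ b ≠ c ∧
    h (p0 a) = true ∧ h (p1 a) = true ∧
    h (p0 b) = false ∧ h (p1 b) = false ∧
    h (p0 c) ≠ h (p1 c) ∧ m (p0 c) ≠ p1 c

instance (m : Pt → Pt) (h : Pt → Bool) : Decidable (Matched m h) := by
  unfold Matched; infer_instance

/-- The other point of the arc containing `x`. -/
def arcPartner (x : Pt) : Pt := if x = p0 (arcOf x) then p1 (arcOf x) else p0 (arcOf x)

/-- The point of arc `Aₖ` selected by a Boolean. -/
def arcPt (k : Fin 3) (i : Bool) : Pt := if i then p1 k else p0 k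

/-- The heads of a matched triple with head–head arc `A₀`, where `q + 2` is the head
in the mixed arc. -/
def headsOf (q : Fin 4) (x : Pt) : Bool := decide (x < 2 ∨ x = q.natAdd 2)

/-- The arc containing two tails when `q + 2` is the head in the mixed arc. -/
def tailArc (q : Fin 4) : Fin 3 := -arcOf (q.natAdd 2)

/-- The matching in which the head `q + 2` of the mixed arc is joined to the tail-arc
point selected by `i`, the tail of the mixed arc to the `A₀` point selected by `j`, and the
two remaining points to each other. -/
def matchingOf (q : Fin 4) (i j : Bool) (x : Pt) : Pt :=
  (Equiv.swap (q.natAdd 2) (arcPt (tailArc q) i) *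
    Equiv.swap (arcPartner (q.natAdd 2)) (arcPt 0 j) *
    Equiv.swap (arcPt 0 !j) (arcPt (tailArc q) !i)) x

/-- The sign assignment making every 3-sign equal to `t`. -/
def signsOf (m : Pt → Pt) (h : Pt → Bool) (t : ℤˣ) (x : Pt) : ℤˣ :=
  t * (parity m x * direction m h x)

theorem threeSign_signsOf (m : Pt → Pt) (h : Pt → Bool) (t : ℤˣ) (x : Pt) :
    threeSign m h (signsOf m h t) x = t := by
  rw [threeSign, signsOf, mul_assoc, mul_assoc, Int.units_mul_self, mul_one]

theorem eq_signsOf {m : Pt → Pt} {h : Pt → Bool} {s : Pt → ℤˣ} {t : ℤˣ}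
    (ht : ∀ x, threeSign m h s x = t) : s = signsOf m h t := by
  funext x
  rw [signsOf, ← ht x, threeSign, mul_assoc (s x), mul_assoc (s x), Int.units_mul_self, mul_one]

theorem isMatching_matchingOf : ∀ q i j, IsMatching (matchingOf q i j) := by
  decide +kernel

theorem headTail_matchingOf : ∀ q i j, HeadTail (matchingOf q i j) (headsOf q) := by
  decide +kernel

theorem matched_matchingOf : ∀ q i j, Matched (matchingOf q i j) (headsOf q) := by
  decide +kernel

theorem signOnChords_signsOf : ∀ q i j t, SignOnChords (matchingOf q i j)
    (signsOf (matchingOf q i j) (headsOf q) t) := by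
  decide +kernel

theorem exists_mixed_head : ∀ (b c : Fin 3) (i : Bool), b ≠ 0 → c ≠ 0 → b ≠ c →
    ∃ q : Fin 4, q.natAdd 2 = arcPt c i ∧ arcPartner (q.natAdd 2) = arcPt c (!i) ∧
      tailArc q = b := by
  decide +kernel

theorem pt_cases : ∀ (q : Fin 4) (x : Pt),
    headsOf q x = true ∧ (x = 0 ∨ x = 1 ∨ x = q.natAdd 2) ∨
      headsOf q x = false ∧ (x = arcPartner (q.natAdd 2) ∨ ∃ i, x = arcPt (tailArc q) i) := by
  decide +kernel

theorem exists_headsOf_eq {m : Pt → Pt} {h : Pt → Bool} (hm : IsMatching m)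
    (hM : Matched m h) (h0 : h 0 = true) (h1 : h 1 = true) :
    ∃ q : Fin 4, h = headsOf q ∧ m (q.natAdd 2) ≠ arcPartner (q.natAdd 2) := by
  obtain ⟨a, b, c, -, -, hbc, -, -, hb0, hb1, hc, hmc⟩ := hM
  have b_ne : b ≠ 0 := by rintro rfl; exact absurd (h0.symm.trans hb0) (by decide)
  have c_ne : c ≠ 0 := by rintro rfl; exact hc (h0.trans h1.symm)
  have htails : ∀ i, h (arcPt b i) = false := by rintro (_ | _) <;> assumption
  obtain ⟨i, hi, hi', hmi⟩ : ∃ i, h (arcPt c i) = true ∧ h (arcPt c !i) = false ∧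
      m (arcPt c i) ≠ arcPt c !i := by
    cases h0c : h (p0 c) with
    | true => exact ⟨false, h0c, by simpa [h0c, arcPt] using hc.symm, hmc⟩
    | false =>
      refine ⟨true, by simpa [h0c, arcPt] using hc.symm, h0c, fun e => hmc ?_⟩
      have e' : m (p1 c) = p0 c := e
      rw [← e', hm.1]
  obtain ⟨q, hq, hq', rfl⟩ := exists_mixed_head b c i b_ne c_ne hbc
  rw [← hq] at hi hmi
  rw [← hq'] at hi' hmi
  refine ⟨q, funext fun x => ?_, hmi⟩
  rcases pt_cases q x with ⟨e, rfl | rfl | rfl⟩ | ⟨e, rfl | ⟨i, rfl⟩⟩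
  · rw [e, h0]
  · rw [e, h1]
  · rw [e, hi]
  · rw [e, hi']
  · rw [e, htails]

theorem matching_on_heads : ∀ (q : Fin 4) (a b c : Pt),
    headsOf q a = false → headsOf q b = false → headsOf q c = false →
    a ≠ b → a ≠ c → b ≠ c → c ≠ arcPartner (q.natAdd 2) →
    ∃ i j, a = matchingOf q i j 0 ∧ b = matchingOf q i j 1 ∧
      c = matchingOf q i j (q.natAdd 2) := by
  decide +kernel

theorem exists_matchingOf_eq {m : Pt → Pt} {q : Fin 4} (hm : IsMatching m)
    (hh : HeadTail m (headsOf q)) (hq : m (q.natAdd 2) ≠ arcPartner (q.natAdd 2)) :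
    ∃ i j, m = matchingOf q i j := by
  have inj : Function.Injective m := Function.Involutive.injective hm.1
  have head0 : headsOf q 0 = true := by simp [headsOf]
  have head1 : headsOf q 1 = true := by simp [headsOf]
  have headq : headsOf q (q.natAdd 2) = true := by simp [headsOf]
  have ne0 : (0 : Pt) ≠ q.natAdd 2 := by clear * -; revert q; decide
  have ne1 : (1 : Pt) ≠ q.natAdd 2 := by clear * -; revert q; decide
  obtain ⟨i, j, e0, e1, eq⟩ := matching_on_heads q (m 0) (m 1) (m (q.natAdd 2))
    (by rw [hh, head0]; rfl) (by rw [hh, head1]; rfl) (by rw [hh, headq]; rfl)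
    (inj.ne (by decide)) (inj.ne ne0) (inj.ne ne1) hq
  have on_heads : ∀ x, headsOf q x = true → m x = matchingOf q i j x := by
    intro x hx
    rcases pt_cases q x with ⟨-, rfl | rfl | rfl⟩ | ⟨hx', -⟩
    · exact e0
    · exact e1
    · exact eq
    · exact absurd (hx.symm.trans hx') (by decide)
  refine ⟨i, j, funext fun x => ?_⟩
  cases hx : headsOf q x with
  | true => exact on_heads x hx
  | false =>
    have hy := on_heads (matchingOf q i j x) (by rw [headTail_matchingOf, hx]; rfl)
    rw [(isMatching_matchingOf q i j).1] at hy
    rw [← hy, hm.1, hy]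

/-- The configuration with given matching data and common 3-sign `t`. -/
def configOf (p : Fin 4 × Bool × Bool × ℤˣ) : (Pt → Pt) × (Pt → Bool) × (Pt → ℤˣ) :=
  let m := matchingOf p.1 p.2.1 p.2.2.1
  (m, headsOf p.1, signsOf m (headsOf p.1) p.2.2.2)

theorem headsOf_injective : Function.Injective headsOf := by
  decide +kernel

theorem matchingOf_inj : ∀ q i j i' j', matchingOf q i j = matchingOf q i' j' →
    i = i' ∧ j = j' := by
  decide +kernel

theorem configOf_injective : Function.Injective configOf := by
  rintro ⟨q, i, j, t⟩ ⟨q', i', j', t'⟩ h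
  simp only [configOf, Prod.mk.injEq] at h
  obtain ⟨hm, hh, hs⟩ := h
  obtain rfl := headsOf_injective hh
  obtain ⟨rfl, rfl⟩ := matchingOf_inj _ _ _ _ _ hm
  have ht := threeSign_signsOf (matchingOf q i j) (headsOf q) t 0
  rw [hs, threeSign_signsOf] at ht
  rw [ht]


/-- There are exactly 32 signed matched triple configurations in which
the arc `A₀ = {0,1}` is the arc containing the two heads and all three chords have the
same 3-sign (the count of 3-movable triples, up to rotation placing the head–head arc
at `A₀`). -/
theorem card_movable_triples_headArc_zero :
    (Finset.univ.filter (fun c : (Pt → Pt) × (Pt → Bool) × (Pt → ℤˣ) =>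
        IsMatching c.1 ∧ HeadTail c.1 c.2.1 ∧ SignOnChords c.1 c.2.2 ∧
        Matched c.1 c.2.1 ∧ c.2.1 0 = true ∧ c.2.1 1 = true ∧
        ∀ x y : Pt, threeSign c.1 c.2.1 c.2.2 x = threeSign c.1 c.2.1 c.2.2 y)).card
      = 32 := by
  rw [show (32 : ℕ) = (Finset.univ.image configOf).card by
    rw [Finset.card_image_of_injective _ configOf_injective]; decide]
  refine congrArg Finset.card (Finset.ext ?_)
  rintro ⟨m, h, s⟩
  simp only [Finset.mem_filter, Finset.mem_univ, true_and, Finset.mem_image]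
  constructor
  · rintro ⟨hm, hh, -, hM, h0, h1, hs⟩
    obtain ⟨q, rfl, hq⟩ := exists_headsOf_eq hm hM h0 h1
    obtain ⟨i, j, rfl⟩ := exists_matchingOf_eq hm hh hq
    exact ⟨(q, i, j, _), Prod.ext rfl (Prod.ext rfl (eq_signsOf fun x => hs x 0).symm)⟩
  · rintro ⟨⟨q, i, j, t⟩, hp⟩
    simp only [configOf, Prod.mk.injEq] at hp
    obtain ⟨rfl, rfl, rfl⟩ := hp
    exact ⟨isMatching_matchingOf q i j, headTail_matchingOf q i j,
      signOnChords_signsOf q i j t, matched_matchingOf q i j, by simp [headsOf],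
      by simp [headsOf], fun x y => by simp only [threeSign_signsOf]⟩
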